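/- Let 0 ≤ q < p ≤ n and let z₁, z₂ be integers with 0 ≤ z₁, z₂ ≤ r−1 and z₁ + a z₂ ≡ i_q − i_p (mod r). Then at least one of the following holds: (i) z₁ ≥ i_{p−1} − i_p; (ii) there exists t with 1 ≤ t ≤ α_p − 2 such that z₁ ≥ i_{p−1} − (t+1) i_p and z₂ ≥ t j_p − j_{p−1}; (iii) z₂ ≥ j_{p+1} − j_p. (Equivalently, the monomial x^{z₁}y^{z₂} ∈ S_{i_q − i_p} factors as x^{i_{p−1}−i_p}·A with A ∈ S_{i_q − i_{p−1}}, or as x^{i_{p−1}−(t+1)i_p} y^{t j_p − j_{p−1}}·B with B ∈ S_{i_q}, or as y^{j_{p+1}−j_p}·C with C ∈ S_{i_q − i_{p+1}}.) -/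

import Mathlib

/-- The two-step linear recursion `s₀ = x0`, `s₁ = x1`, `s_{t+1} = α_t s_t − s_{t−1}`;
with `x0 = r, x1 = a` this is the i-series and with `x0 = 0, x1 = 1` the j-series. -/
def ser (x0 x1 : ℤ) (α : ℕ → ℕ) : ℕ → ℤ
  | 0 => x0
  | 1 => x1
  | t + 2 => (α (t + 1) : ℤ) * ser x0 x1 α (t + 1) - ser x0 x1 α t

/-- Hirzebruch–Jung (negative) continued fraction value of a list. -/
def hj : List ℚ → ℚ
  | [] => 0
  | q :: L => q - 1 / hj L

theorem ser_add_two (x y : ℤ) (α : ℕ → ℕ) (t : ℕ) :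
    ser x y α (t + 2) = (α (t + 1) : ℤ) * ser x y α (t + 1) - ser x y α t := rfl

theorem one_lt_hj (L : List ℚ) (hL : ∀ x ∈ L, 2 ≤ x) (hne : L ≠ []) : 1 < hj L := by
  induction L with
  | nil => exact absurd rfl hne
  | cons x L ih =>
    have hx : 2 ≤ x := hL x (by simp)
    rcases eq_or_ne L [] with rfl | hL'
    · simp only [hj, div_zero]
      linarith
    · have h := ih (fun y hy => hL y (by simp [hy])) hL'
      have h1 : 1 / hj L < 1 := (div_lt_one (by linarith)).2 h
      simp only [hj]
      linarith

theorem inv_hj_mem_Ico (L : List ℚ) (hL : ∀ x ∈ L, 2 ≤ x) :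
    0 ≤ 1 / hj L ∧ 1 / hj L < 1 := by
  rcases eq_or_ne L [] with rfl | hne
  · simp [hj]
  · have h := one_lt_hj L hL hne
    exact ⟨by positivity, (div_lt_one (by linarith)).2 h⟩

theorem hj_map_range_succ (α : ℕ → ℕ) (t m : ℕ) :
    hj ((List.range (m + 1)).map fun s => (α (t + s + 1) : ℚ)) =
      α (t + 1) - 1 / hj ((List.range m).map fun s => (α (t + 1 + s + 1) : ℚ)) := by
  rw [List.range_succ_eq_map, List.map_cons, List.map_map, hj]
  have h : ((fun s => (α (t + s + 1) : ℚ)) ∘ Nat.succ) =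
      fun s => (α (t + 1 + s + 1) : ℚ) := by
    funext s
    simp only [Function.comp, Nat.succ_eq_add_one]
    rw [show t + (s + 1) + 1 = t + 1 + s + 1 by ring]
  rw [h]

theorem two_le_of_mem_map_range (α : ℕ → ℕ) (n t m : ℕ)
    (hα : ∀ t, 1 ≤ t → t ≤ n → 2 ≤ α t) (h : t + m ≤ n) :
    ∀ x ∈ (List.range m).map fun s => (α (t + s + 1) : ℚ), 2 ≤ x := by
  intro x hx
  obtain ⟨s, hs, rfl⟩ := List.mem_map.1 hx
  have hs' := List.mem_range.1 hs
  exact_mod_cast hα (t + s + 1) (by omega) (by omega)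

/-- Consecutive terms of the i-series have as quotient a tail of the continued fraction. -/
theorem ser_eq_mul_hj (r a n : ℕ) (α : ℕ → ℕ) (ha : 1 ≤ a)
    (hα : ∀ t, 1 ≤ t → t ≤ n → 2 ≤ α t)
    (hval : hj ((List.range n).map fun t => (α (t + 1) : ℚ)) = (r : ℚ) / (a : ℚ))
    (t : ℕ) : ∀ m, n = t + m + 1 → 0 < ser r a α (t + 1) ∧
      (ser r a α t : ℚ) = ser r a α (t + 1) *
        hj ((List.range (m + 1)).map fun s => (α (t + s + 1) : ℚ)) := by
  induction t with
  | zero =>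
    intro m hm
    have ha' : (a : ℚ) ≠ 0 := by positivity
    refine ⟨by simp only [ser]; exact_mod_cast ha, ?_⟩
    have h : m + 1 = n := by omega
    simp only [h, zero_add, hval, ser]
    push_cast
    field_simp
  | succ t ih =>
    intro m hm
    obtain ⟨hpos, heq⟩ := ih (m + 1) (by omega)
    rw [hj_map_range_succ] at heq
    have hgt := one_lt_hj _ (two_le_of_mem_map_range α n (t + 1) (m + 1) hα (by omega))
      (by simp)
    set h := hj ((List.range (m + 1)).map fun s => (α (t + 1 + s + 1) : ℚ))
    have h0 : 0 < h := by linarith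
    have hposQ : (0 : ℚ) < ser r a α (t + 1) := by exact_mod_cast hpos
    have hs : (ser r a α (t + 2) : ℚ) = ser r a α (t + 1) * (1 / h) := by
      rw [ser_add_two]
      push_cast
      rw [heq]
      ring
    refine ⟨?_, ?_⟩
    · have : (0 : ℚ) < ser r a α (t + 2) := by rw [hs]; positivity
      exact_mod_cast this
    · change (ser r a α (t + 1) : ℚ) = ser r a α (t + 2) * h
      rw [hs]
      field_simp

theorem ser_nonneg_lt (r a n : ℕ) (α : ℕ → ℕ) (ha : 1 ≤ a)
    (hα : ∀ t, 1 ≤ t → t ≤ n → 2 ≤ α t)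
    (hval : hj ((List.range n).map fun t => (α (t + 1) : ℚ)) = (r : ℚ) / (a : ℚ))
    (t : ℕ) (ht : t + 1 ≤ n) :
    0 ≤ ser r a α (t + 2) ∧ ser r a α (t + 2) < ser r a α (t + 1) := by
  obtain ⟨m, rfl⟩ := Nat.exists_eq_add_of_le ht
  obtain ⟨hpos, heq⟩ := ser_eq_mul_hj r a _ α ha hα hval t m (by ring)
  rw [hj_map_range_succ] at heq
  obtain ⟨h0, h1⟩ := inv_hj_mem_Ico _
    (two_le_of_mem_map_range α _ (t + 1) m hα le_rfl)
  set h := 1 / hj ((List.range m).map fun s => (α (t + 1 + s + 1) : ℚ))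
  have hposQ : (0 : ℚ) < ser r a α (t + 1) := by exact_mod_cast hpos
  have hs : (ser r a α (t + 2) : ℚ) = ser r a α (t + 1) * h := by
    rw [ser_add_two]
    push_cast
    rw [heq]
    ring
  constructor
  · have : (0 : ℚ) ≤ ser r a α (t + 2) := by rw [hs]; positivity
    exact_mod_cast this
  · have : (ser r a α (t + 2) : ℚ) < ser r a α (t + 1) := by rw [hs]; nlinarith
    exact_mod_cast this

theorem ser_zero_one_nonneg_lt (n : ℕ) (α : ℕ → ℕ)
    (hα : ∀ t, 1 ≤ t → t ≤ n → 2 ≤ α t) (t : ℕ) (ht : t ≤ n) :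
    0 ≤ ser 0 1 α t ∧ ser 0 1 α t < ser 0 1 α (t + 1) := by
  induction t with
  | zero => simp [ser]
  | succ t ih =>
    obtain ⟨h0, h1⟩ := ih (by omega)
    have h2 : (2 : ℤ) ≤ α (t + 1) := by exact_mod_cast hα (t + 1) (by omega) ht
    refine ⟨by omega, ?_⟩
    rw [ser_add_two]
    nlinarith

theorem ser_zero_one_le (n : ℕ) (α : ℕ → ℕ)
    (hα : ∀ t, 1 ≤ t → t ≤ n → 2 ≤ α t) (q m : ℕ) (hm : q + m ≤ n) :
    ser 0 1 α q ≤ ser 0 1 α (q + m) := by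
  induction m with
  | zero => exact le_rfl
  | succ m ih =>
    exact (ih (by omega)).trans (ser_zero_one_nonneg_lt n α hα (q + m) (by omega)).2.le

theorem ser_det (r a : ℤ) (α : ℕ → ℕ) (t : ℕ) :
    ser r a α t * ser 0 1 α (t + 1) - ser r a α (t + 1) * ser 0 1 α t = r := by
  induction t with
  | zero => simp [ser]
  | succ t ih =>
    rw [ser_add_two, ser_add_two]
    linear_combination ih

theorem dvd_ser_sub (r a : ℤ) (α : ℕ → ℕ) (t : ℕ) :
    r ∣ ser r a α t - a * ser 0 1 α t ∧
      r ∣ ser r a α (t + 1) - a * ser 0 1 α (t + 1) := by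
  induction t with
  | zero => simp [ser]
  | succ t ih =>
    refine ⟨ih.2, ?_⟩
    obtain ⟨⟨k, hk⟩, ⟨l, hl⟩⟩ := ih
    refine ⟨α (t + 1) * l - k, ?_⟩
    rw [ser_add_two, ser_add_two]
    linear_combination (α (t + 1) : ℤ) * hl - hk

/-- Two vectors of determinant `r` in the lattice `{(x, y) | x + a y ≡ 0 (mod r)}` span it. -/
theorem exists_lattice_coords (r a i i' j j' x y : ℤ) (hr : r ≠ 0)
    (hdet : i' * j - i * j' = r) (hi : r ∣ i - a * j) (hi' : r ∣ i' - a * j')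
    (hxy : r ∣ x + a * y) :
    ∃ c e : ℤ, x = -c * i' + e * i ∧ y = c * j' - e * j := by
  obtain ⟨k, hk⟩ := hi
  obtain ⟨k', hk'⟩ := hi'
  obtain ⟨l, hl⟩ := hxy
  refine ⟨-(l * j + k * y), -(l * j' + k' * y), ?_, ?_⟩ <;> apply mul_left_cancel₀ hr
  · linear_combination (-x) * hdet + i' * (j * hl + y * hk) - i * (j' * hl + y * hk')
  · linear_combination (-y) * hdet - j' * (j * hl + y * hk) + j * (j' * hl + y * hk')

/-- There are no lattice points in the box cut out by two consecutive corners. -/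
theorem le_of_lattice_coords (A i i' j j' jq t c e z : ℤ)
    (ht1 : 1 ≤ t) (htA : t ≤ A - 1)
    (hi : 0 < i) (hi' : (A - 1) * i < i') (hj' : 0 ≤ j') (hjj : j' < j)
    (hq : 0 ≤ jq) (hqj : jq ≤ j')
    (hlow : i' - t * i ≤ -c * i' + e * i)
    (hup : -c * i' + e * i < i' - (t - 1) * i)
    (hz : z - jq = c * j' - e * j) (hz0 : 0 ≤ z) : t * j - j' ≤ z := by
  by_contra! hcon
  rcases le_or_gt (c + 1) 0 with hD | hD
  · have hii : i ≤ i' := by nlinarith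
    have hE : e + t - 1 < c + 1 := by
      by_contra! h
      nlinarith
    nlinarith
  · have hE : (c + 1) * (A - 1) < e + t := by
      by_contra! h
      nlinarith
    have hE' : c + 1 ≤ e := by nlinarith
    nlinarith

/-- factorisation of monomials in `S_{i_q − i_p}`.  If
`0 ≤ z₁, z₂ ≤ r − 1` and `z₁ + a z₂ ≡ i_q − i_p (mod r)` with `q < p ≤ n`, then either
`z₁ ≥ i_{p−1} − i_p`, or `z₁ ≥ i_{p−1} − (t+1) i_p` and `z₂ ≥ t j_p − j_{p−1}` for some
`1 ≤ t ≤ α_p − 2`, or `z₂ ≥ j_{p+1} − j_p`. -/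
theorem stmt_5 (r a n : ℕ) (α : ℕ → ℕ)
    (ha : 1 ≤ a) (har : a < r) (hcop : Nat.Coprime r a) (hn : 1 ≤ n)
    (hα : ∀ t, 1 ≤ t → t ≤ n → 2 ≤ α t)
    (hval : hj ((List.range n).map fun t => (α (t + 1) : ℚ)) = (r : ℚ) / (a : ℚ))
    (p q z₁ z₂ : ℕ) (hqp : q < p) (hp : p ≤ n)
    (hz₁ : z₁ ≤ r - 1) (hz₂ : z₂ ≤ r - 1)
    (hcong : ((z₁ : ℤ) + (a : ℤ) * (z₂ : ℤ)) ≡ ser r a α q - ser r a α p [ZMOD (r : ℤ)]) :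
    (ser r a α (p - 1) - ser r a α p ≤ (z₁ : ℤ)) ∨
    (∃ t : ℕ, 1 ≤ t ∧ t ≤ α p - 2 ∧
      ser r a α (p - 1) - ((t : ℤ) + 1) * ser r a α p ≤ (z₁ : ℤ) ∧
      (t : ℤ) * ser 0 1 α p - ser 0 1 α (p - 1) ≤ (z₂ : ℤ)) ∨
    (ser 0 1 α (p + 1) - ser 0 1 α p ≤ (z₂ : ℤ)) := by
  obtain ⟨s, rfl⟩ : ∃ s, p = s + 1 := ⟨p - 1, by omega⟩
  simp only [Nat.add_sub_cancel]
  have hr : (r : ℤ) ≠ 0 := by omega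
  obtain ⟨hI0, hI1⟩ := ser_nonneg_lt r a n α ha hα hval s hp
  have hIrec := ser_add_two r a α s
  have hJrec := ser_add_two 0 1 α s
  obtain ⟨hJ0, hJ1⟩ := ser_zero_one_nonneg_lt n α hα s (by omega)
  have hq0 := (ser_zero_one_nonneg_lt n α hα q (by omega)).1
  have hqs : ser 0 1 α q ≤ ser 0 1 α s := by
    have h := ser_zero_one_le n α hα q (s - q) (by omega)
    rwa [show q + (s - q) = s by omega] at h
  have hA := hα (s + 1) (by omega) hp
  have hdiv := dvd_ser_sub r a α s
  have hxy : (r : ℤ) ∣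
      ((z₁ : ℤ) + ser r a α (s + 1)) + a * ((z₂ : ℤ) - ser 0 1 α q) := by
    obtain ⟨k, hk⟩ := hcong.symm.dvd
    obtain ⟨l, hl⟩ := (dvd_ser_sub r a α q).1
    exact ⟨k + l, by linear_combination hk + hl⟩
  obtain ⟨c, e, hx, hy⟩ := exists_lattice_coords r a _ _ _ _ _ _ hr
    (ser_det r a α s) hdiv.2 hdiv.1 hxy
  have hex : ∃ t : ℕ, ser r a α s - ((t : ℤ) + 1) * ser r a α (s + 1) ≤ z₁ := by
    refine ⟨α (s + 1) - 1, ?_⟩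
    rw [Nat.cast_sub (by omega)]
    push_cast
    linarith
  classical
  obtain ⟨t, hmin, hlt⟩ : ∃ t : ℕ,
      ser r a α s - ((t : ℤ) + 1) * ser r a α (s + 1) ≤ z₁ ∧
      ∀ u < t, ¬ ser r a α s - ((u : ℤ) + 1) * ser r a α (s + 1) ≤ z₁ :=
    ⟨Nat.find hex, Nat.find_spec hex, fun _ => Nat.find_min hex⟩
  have htA : t ≤ α (s + 1) - 1 := by
    by_contra! h
    apply hlt _ h
    rw [Nat.cast_sub (by omega)]
    push_cast
    linarith
  rcases Nat.eq_zero_or_pos t with rfl | ht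
  · left
    simpa using hmin
  right
  have hprev := hlt (t - 1) (by omega)
  rw [Nat.cast_sub ht] at hprev
  push_cast at hprev
  have hz : (t : ℤ) * ser 0 1 α (s + 1) - ser 0 1 α s ≤ z₂ :=
    le_of_lattice_coords (α (s + 1)) (ser r a α (s + 1)) (ser r a α s) (ser 0 1 α (s + 1))
      (ser 0 1 α s) (ser 0 1 α q) t c e z₂ (by omega) (by omega) (by omega)
      (by linarith) hJ0 hJ1 hq0 hqs (by linarith) (by linarith) hy (by omega)
  by_cases htt : t ≤ α (s + 1) - 2
  · exact Or.inl ⟨t, ht, htt, hmin, hz⟩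
  · right
    have hteq : (t : ℤ) = α (s + 1) - 1 := by omega
    rw [hteq] at hz
    change ser 0 1 α (s + 2) - _ ≤ _
    linarith
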